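/- Assume (F0)-(F5). Then for every t ∈ [0,T] and every u₁, u₂ ∈ X, the energy-dissipation cost satisfies c_t(u₁, u₂) = 0 if and only if u₁ = u₂. -/

import Mathlib

open Set Filter Topology MeasureTheory
open scoped RealInnerProductSpace

noncomputable def cost {X : Type*} [NormedAddCommGroup X] [InnerProductSpace ℝ X]
    (A B Binv : X →L[ℝ] X) (gradF : ℝ → X → X) (t : ℝ) (u₁ u₂ : X) : ℝ :=
  sInf { c : ℝ | ∃ (N : ℕ) (v v' v'' : ℝ → X),
    -- v is C¹ on [-N,N] with derivative v'
    (∀ s ∈ Set.Icc (-(N : ℝ)) (N : ℝ),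
      HasDerivWithinAt v (v' s) (Set.Icc (-(N : ℝ)) (N : ℝ)) s) ∧
    ContinuousOn v' (Set.Icc (-(N : ℝ)) (N : ℝ)) ∧
    -- v' is absolutely continuous with (second) derivative v'' in L²
    MeasureTheory.IntegrableOn v'' (Set.Icc (-(N : ℝ)) (N : ℝ)) ∧
    MeasureTheory.IntegrableOn (fun s => ‖v'' s‖ ^ 2) (Set.Icc (-(N : ℝ)) (N : ℝ)) ∧
    (∀ s ∈ Set.Icc (-(N : ℝ)) (N : ℝ), v' s = v' (-(N : ℝ)) + ∫ r in (-(N : ℝ))..s, v'' r) ∧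
    -- boundary conditions
    v (-(N : ℝ)) = u₁ ∧ v (N : ℝ) = u₂ ∧ v' (-(N : ℝ)) = 0 ∧ v' (N : ℝ) = 0 ∧
    -- value of the functional
    c = (1 / 2) * ∫ s in (-(N : ℝ))..(N : ℝ),
      (⟪gradF t (v s) + A (v'' s), Binv (gradF t (v s) + A (v'' s))⟫
        + ⟪v' s, B (v' s)⟫) }

lemma posdef_coercive {X : Type*} [NormedAddCommGroup X] [InnerProductSpace ℝ X]
    [FiniteDimensional ℝ X] (Q : X →L[ℝ] X) (hQ : ∀ x : X, x ≠ 0 → 0 < ⟪x, Q x⟫) :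
    ∃ β > (0 : ℝ), ∀ x : X, β * ‖x‖ ^ 2 ≤ ⟪x, Q x⟫ := by
  have : ProperSpace X := FiniteDimensional.proper ℝ X
  have hc : Continuous (fun x : X => ⟪x, Q x⟫) := continuous_id.inner Q.continuous
  obtain ⟨β, hβ, hβ'⟩ : ∃ β > (0 : ℝ), ∀ x ∈ Metric.sphere (0 : X) 1, β ≤ ⟪x, Q x⟫ := by
    rcases (Metric.sphere (0 : X) 1).eq_empty_or_nonempty with he | hne
    · exact ⟨1, one_pos, by simp [he]⟩
    · obtain ⟨x, hx, hmin⟩ := (isCompact_sphere (0 : X) 1).exists_isMinOn hne hc.continuousOn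
      refine ⟨⟪x, Q x⟫, hQ x ?_, fun y hy => hmin hy⟩
      rintro rfl
      simp at hx
  refine ⟨β, hβ, fun x => ?_⟩
  by_cases hx : x = 0
  · simp [hx]
  have hn : 0 < ‖x‖ := norm_pos_iff.mpr hx
  have h1 := hβ' (‖x‖⁻¹ • x) (by simp [norm_smul, hn.ne'])
  rw [map_smul, inner_smul_left, inner_smul_right] at h1
  simp only [conj_trivial] at h1
  have h2 : ‖x‖ ^ 2 * (‖x‖⁻¹ * (‖x‖⁻¹ * ⟪x, Q x⟫)) = ⟪x, Q x⟫ := by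
    field_simp
  have h3 := mul_le_mul_of_nonneg_left h1 (sq_nonneg ‖x‖)
  rw [h2] at h3
  linarith

lemma L1_le {h : ℝ → ℝ} {c d a b η : ℝ} (hη : 0 < η) (hca : c ≤ a) (hab : a ≤ b) (hbd : b ≤ d)
    (hlen : b - a ≤ 1) (h1 : IntegrableOn h (Icc c d))
    (h2 : IntegrableOn (fun s => h s ^ 2) (Icc c d))
    (hle : ∫ s in c..d, h s ^ 2 ≤ η ^ 2) : ∫ s in a..b, h s ≤ η := by
  have hsub : uIcc a b ⊆ Icc c d := by
    rw [uIcc_of_le hab]; exact Icc_subset_Icc hca hbd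
  have i1 : IntervalIntegrable h volume a b := (h1.mono_set hsub).intervalIntegrable
  have i2 : IntervalIntegrable (fun s => h s ^ 2) volume a b :=
    (h2.mono_set hsub).intervalIntegrable
  have i3 : IntervalIntegrable (fun s => h s ^ 2) volume c d := by
    apply IntegrableOn.intervalIntegrable
    rwa [uIcc_of_le (by linarith)]
  have e1 : ∫ s in a..b, h s ^ 2 ≤ η ^ 2 :=
    (intervalIntegral.integral_mono_interval hca hab hbd
      (Eventually.of_forall fun s => sq_nonneg _) i3).trans hle
  have e2 : ∫ s in a..b, h s ≤ ∫ s in a..b, (η / 2 + (1 / (2 * η)) * h s ^ 2) := by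
    apply intervalIntegral.integral_mono_on hab i1
      (intervalIntegrable_const.add (i2.const_mul _))
    intro s _
    have : η / 2 + (1 / (2 * η)) * h s ^ 2 - h s = (η - h s) ^ 2 / (2 * η) := by
      field_simp; ring
    have : 0 ≤ (η - h s) ^ 2 / (2 * η) := by positivity
    linarith
  rw [intervalIntegral.integral_add intervalIntegrable_const (i2.const_mul _),
    intervalIntegral.integral_const, intervalIntegral.integral_const_mul, smul_eq_mul] at e2
  have e3 : (1 / (2 * η)) * ∫ s in a..b, h s ^ 2 ≤ (1 / (2 * η)) * η ^ 2 :=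
    mul_le_mul_of_nonneg_left e1 (by positivity)
  have e4 : (1 / (2 * η)) * η ^ 2 = η / 2 := by field_simp
  have e5 : (b - a) * (η / 2) ≤ 1 * (η / 2) := mul_le_mul_of_nonneg_right hlen (by positivity)
  linarith

lemma exists_small {h : ℝ → ℝ} {a η : ℝ} (hη : 0 < η)
    (hc : ContinuousOn h (Icc a (a + 1 / 3))) (hle : ∫ s in a..(a + 1 / 3), h s ≤ η) :
    ∃ s ∈ Icc a (a + 1 / 3), h s ≤ 4 * η := by
  by_contra! hcon
  have hab : a ≤ a + 1 / 3 := by linarith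
  have : ∫ s in a..(a + 1 / 3), (4 * η) ≤ ∫ s in a..(a + 1 / 3), h s := by
    apply intervalIntegral.integral_mono_on hab intervalIntegrable_const
    · apply ContinuousOn.intervalIntegrable
      rwa [uIcc_of_le hab]
    · intro s hs; exact (hcon s hs).le
  rw [intervalIntegral.integral_const, smul_eq_mul] at this
  linarith

/-- The main estimate: if both dissipation terms are small, contradiction. -/
lemma key_estimate {X : Type*} [NormedAddCommGroup X] [InnerProductSpace ℝ X]
    [FiniteDimensional ℝ X] (A : X →L[ℝ] X) (G : X → X) (hG : Continuous G) (u₁ u₂ : X)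
    (r κ M ρ η : ℝ) (hη : 0 < η) (hr : 0 < r) (hru : r ≤ dist u₂ u₁)
    (hM : ∀ p ∈ Metric.sphere u₁ r, ‖G p‖ ≤ M) (hM0 : 0 ≤ M)
    (hκ : ∀ p ∈ Metric.sphere u₁ r, ∀ x, dist x p ≤ ρ → κ ≤ ⟪G p, G x⟫) (hκ0 : 0 < κ)
    (hηr : η < r) (hηρ : η ≤ ρ) (hηM : M * (η + ‖A‖ * (8 * η)) < κ / 3)
    (N : ℝ) (hN : 0 ≤ N) (v v' v'' : ℝ → X)
    (hv : ∀ s ∈ Icc (-N) N, HasDerivWithinAt v (v' s) (Icc (-N) N) s)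
    (hv'c : ContinuousOn v' (Icc (-N) N))
    (hv''i : IntegrableOn v'' (Icc (-N) N))
    (hv' : ∀ s ∈ Icc (-N) N, v' s = v' (-N) + ∫ r in (-N)..s, v'' r)
    (hb1 : v (-N) = u₁) (hb2 : v N = u₂)
    (hg2 : IntegrableOn (fun s => ‖G (v s) + A (v'' s)‖ ^ 2) (Icc (-N) N))
    (hg : ∫ s in (-N)..N, ‖G (v s) + A (v'' s)‖ ^ 2 ≤ η ^ 2)
    (hd : ∫ s in (-N)..N, ‖v' s‖ ^ 2 ≤ η ^ 2) : False := by
  have : CompleteSpace X := FiniteDimensional.complete ℝ X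
  have hvc : ContinuousOn v (Icc (-N) N) := fun s hs => (hv s hs).continuousWithinAt
  have hNN : -N ≤ N := by linarith
  have hGvc : ContinuousOn (fun s => G (v s)) (Icc (-N) N) := hG.comp_continuousOn hvc
  have hAi : IntegrableOn (fun s => A (v'' s)) (Icc (-N) N) := A.integrable_comp hv''i
  have hgi : IntegrableOn (fun s => G (v s) + A (v'' s)) (Icc (-N) N) :=
    (hGvc.integrableOn_Icc).add hAi
  have hdi : IntegrableOn (fun s => ‖v' s‖) (Icc (-N) N) := hv'c.norm.integrableOn_Icc
  have hdi2 : IntegrableOn (fun s => ‖v' s‖ ^ 2) (Icc (-N) N) :=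
    (hv'c.norm.pow 2).integrableOn_Icc
  have Lg : ∀ a b, -N ≤ a → a ≤ b → b ≤ N → b - a ≤ 1 →
      ∫ s in a..b, ‖G (v s) + A (v'' s)‖ ≤ η := fun a b h1 h2 h3 h4 =>
    L1_le hη h1 h2 h3 h4 hgi.norm hg2 hg
  have Ld : ∀ a b, -N ≤ a → a ≤ b → b ≤ N → b - a ≤ 1 →
      ∫ s in a..b, ‖v' s‖ ≤ η := fun a b h1 h2 h3 h4 =>
    L1_le hη h1 h2 h3 h4 hdi hdi2 hd
  -- displacement
  have disp : ∀ a b, -N ≤ a → a ≤ b → b ≤ N → b - a ≤ 1 → dist (v b) (v a) ≤ η := by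
    intro a b h1 h2 h3 h4
    have hsub : Icc a b ⊆ Icc (-N) N := Icc_subset_Icc h1 h3
    have hint : ∫ s in a..b, v' s = v b - v a := by
      apply intervalIntegral.integral_eq_sub_of_hasDerivAt_of_le h2 (hvc.mono hsub)
      · intro s hs
        exact (hv s (hsub (Ioo_subset_Icc_self hs))).hasDerivAt
          (Icc_mem_nhds (h1.trans_lt hs.1) (hs.2.trans_le h3))
      · apply ContinuousOn.intervalIntegrable
        rw [uIcc_of_le h2]; exact hv'c.mono hsub
    rw [dist_eq_norm, ← hint]
    exact (intervalIntegral.norm_integral_le_integral_norm h2).trans (Ld a b h1 h2 h3 h4)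
  -- hitting point
  obtain ⟨σ, hσ, hσr⟩ : ∃ σ ∈ Icc (-N) N, dist (v σ) u₁ = r := by
    have hcont : ContinuousOn (fun s => dist (v s) u₁) (Icc (-N) N) :=
      (continuous_id.dist continuous_const).comp_continuousOn hvc
    have := intermediate_value_Icc hNN hcont
    obtain ⟨σ, hσ, h⟩ := this (show r ∈ Icc _ _ from ⟨by simp [hb1, hr.le], by simpa [hb2] using hru⟩)
    exact ⟨σ, hσ, h⟩
  have hσ1 : -N ≤ σ - 1 := by
    by_contra! h
    have := disp (-N) σ le_rfl hσ.1 hσ.2 (by linarith)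
    rw [hb1, hσr] at this
    linarith
  have hsph : v σ ∈ Metric.sphere u₁ r := hσr
  set p := v σ with hp
  obtain ⟨s1, hs1, hs1'⟩ := exists_small (h := fun s => ‖v' s‖) (a := σ - 1) hη
    (hv'c.norm.mono (Icc_subset_Icc hσ1 (by linarith [hσ.2])))
    (Ld _ _ hσ1 (by linarith) (by linarith [hσ.2]) (by linarith))
  obtain ⟨s2, hs2, hs2'⟩ := exists_small (h := fun s => ‖v' s‖) (a := σ - 1 / 3) hη
    (hv'c.norm.mono (Icc_subset_Icc (by linarith) (by linarith [hσ.2])))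
    (Ld _ _ (by linarith) (by linarith) (by linarith [hσ.2]) (by linarith))
  have q1 : -N ≤ s1 := by linarith [hs1.1]
  have q2 : s1 + 1 / 3 ≤ s2 := by linarith [hs1.2, hs2.1]
  have q3 : s2 ≤ σ := by linarith [hs2.2]
  have q4 : σ - 1 ≤ s1 := hs1.1
  have q5 : s2 ≤ N := q3.trans hσ.2
  have q6 : s1 ≤ s2 := by linarith
  have hsub : uIcc s1 s2 ⊆ Icc (-N) N := by
    rw [uIcc_of_le q6]; exact Icc_subset_Icc q1 q5
  have j1 : IntervalIntegrable (fun s => G (v s)) volume s1 s2 :=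
    (hGvc.mono hsub).intervalIntegrable
  have j2 : IntervalIntegrable (fun s => A (v'' s)) volume s1 s2 :=
    (hAi.mono_set hsub).intervalIntegrable
  have j3 : IntervalIntegrable v'' volume s1 s2 := (hv''i.mono_set hsub).intervalIntegrable
  have hint2 : ∫ s in s1..s2, v'' s = v' s2 - v' s1 := by
    rw [hv' s2 ⟨by linarith, q5⟩, hv' s1 ⟨q1, by linarith⟩, add_sub_add_left_eq_sub,
      intervalIntegral.integral_interval_sub_left]
    · exact (hv''i.mono_set (by
        rw [uIcc_of_le (by linarith)]; exact Icc_subset_Icc le_rfl q5)).intervalIntegrable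
    · exact (hv''i.mono_set (by
        rw [uIcc_of_le q1]; exact Icc_subset_Icc le_rfl (by linarith))).intervalIntegrable
  have hsum : ∫ s in s1..s2, G (v s) =
      (∫ s in s1..s2, (G (v s) + A (v'' s))) - A (v' s2 - v' s1) := by
    rw [intervalIntegral.integral_add j1 j2, A.intervalIntegral_comp_comm j3, hint2]
    abel
  have hup : ‖∫ s in s1..s2, G (v s)‖ ≤ η + ‖A‖ * (8 * η) := by
    rw [hsum]
    refine (norm_sub_le _ _).trans (add_le_add ?_ ?_)
    · exact (intervalIntegral.norm_integral_le_integral_norm q6).trans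
        (Lg _ _ q1 q6 q5 (by linarith))
    · refine (A.le_opNorm _).trans (mul_le_mul_of_nonneg_left ?_ (norm_nonneg _))
      refine (norm_sub_le _ _).trans ?_
      linarith
  have hlow : κ / 3 ≤ ⟪G p, ∫ s in s1..s2, G (v s)⟫ := by
    have e : ⟪G p, ∫ s in s1..s2, G (v s)⟫ = ∫ s in s1..s2, ⟪G p, G (v s)⟫ :=
      ((innerSL ℝ (G p)).intervalIntegral_comp_comm j1).symm
    rw [e]
    have : ∫ s in s1..s2, κ ≤ ∫ s in s1..s2, ⟪G p, G (v s)⟫ := by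
      apply intervalIntegral.integral_mono_on q6 intervalIntegrable_const
      · exact (continuousOn_const.inner (hGvc.mono hsub)).intervalIntegrable
      · intro s hs
        apply hκ p hsph
        rw [dist_comm]
        exact (disp s σ (by linarith [hs.1]) (by linarith [hs.2]) hσ.2
          (by linarith [hs.1])).trans hηρ
    rw [intervalIntegral.integral_const, smul_eq_mul] at this
    have h3 : 1 / 3 * κ ≤ (s2 - s1) * κ := mul_le_mul_of_nonneg_right (by linarith) hκ0.le
    linarith
  have : ⟪G p, ∫ s in s1..s2, G (v s)⟫ ≤ M * (η + ‖A‖ * (8 * η)) :=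
    (real_inner_le_norm _ _).trans (mul_le_mul (hM p hsph) hup (norm_nonneg _) hM0)
  linarith

/-- Uniform nonvanishing of a continuous field on a compact set. -/
lemma uniform_field {X : Type*} [NormedAddCommGroup X] [InnerProductSpace ℝ X]
    (G : X → X) (hG : Continuous G) (S : Set X) (hS : IsCompact S)
    (hne : ∀ p ∈ S, G p ≠ 0) :
    ∃ κ > (0 : ℝ), ∃ ρ > (0 : ℝ), ∀ p ∈ S, ∀ x, dist x p ≤ ρ → κ ≤ ⟪G p, G x⟫ := by
  rcases S.eq_empty_or_nonempty with rfl | hSn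
  · exact ⟨1, one_pos, 1, one_pos, by simp⟩
  obtain ⟨q, hq, hmin⟩ := hS.exists_isMinOn hSn (hG.norm.continuousOn)
  have hq0 : 0 < ‖G q‖ := norm_pos_iff.mpr (hne q hq)
  have hU : IsOpen {z : X × X | ‖G q‖ ^ 2 / 2 < ⟪G z.1, G z.2⟫} :=
    isOpen_lt continuous_const ((hG.comp continuous_fst).inner (hG.comp continuous_snd))
  have hK : IsCompact ((fun p : X => (p, p)) '' S) := hS.image (by fun_prop)
  obtain ⟨ρ, hρ, hsub⟩ := hK.exists_cthickening_subset_open hU (by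
    rintro _ ⟨p, hp, rfl⟩
    have h1 : ‖G q‖ ≤ ‖G p‖ := hmin hp
    have h2 : ‖G q‖ ^ 2 ≤ ‖G p‖ ^ 2 := by gcongr
    simp only [mem_ofPred_eq, real_inner_self_eq_norm_sq]
    have : 0 < ‖G q‖ ^ 2 := by positivity
    linarith)
  refine ⟨‖G q‖ ^ 2 / 2, by positivity, ρ, hρ, fun p hp x hx => ?_⟩
  have hmem : (p, x) ∈ Metric.cthickening ρ ((fun p : X => (p, p)) '' S) := by
    refine Metric.mem_cthickening_of_dist_le (p, x) (p, p) ρ _ (mem_image_of_mem _ hp) ?_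
    simp [Prod.dist_eq, hx]
  exact (show ‖G q‖ ^ 2 / 2 < ⟪G p, G x⟫ from hsub hmem).le

/-- Integrability of the squared residual. -/
lemma sq_integrable {X : Type*} [NormedAddCommGroup X] [InnerProductSpace ℝ X]
    [FiniteDimensional ℝ X] (A : X →L[ℝ] X) (f w : ℝ → X) (a b : ℝ)
    (hf : ContinuousOn f (Icc a b)) (hw : IntegrableOn w (Icc a b))
    (hw2 : IntegrableOn (fun s => ‖w s‖ ^ 2) (Icc a b)) :
    IntegrableOn (fun s => ‖f s + A (w s)‖ ^ 2) (Icc a b) := by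
  have hgi : IntegrableOn (fun s => f s + A (w s)) (Icc a b) :=
    hf.integrableOn_Icc.add (A.integrable_comp hw)
  have hdom : IntegrableOn (fun s => 2 * ‖f s‖ ^ 2 + 2 * ‖A‖ ^ 2 * ‖w s‖ ^ 2) (Icc a b) :=
    ((hf.norm.pow 2).integrableOn_Icc.const_mul 2).add (hw2.const_mul _)
  refine Integrable.mono' hdom (hgi.aestronglyMeasurable.norm.pow 2)
    (Eventually.of_forall fun s => ?_)
  rw [Real.norm_of_nonneg (by positivity)]
  have h1 : ‖f s + A (w s)‖ ≤ ‖f s‖ + ‖A‖ * ‖w s‖ :=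
    (norm_add_le _ _).trans (by gcongr; exact A.le_opNorm _)
  calc ‖f s + A (w s)‖ ^ 2 ≤ (‖f s‖ + ‖A‖ * ‖w s‖) ^ 2 := by gcongr
    _ ≤ _ := by nlinarith [sq_nonneg (‖f s‖ - ‖A‖ * ‖w s‖)]

lemma quad_integrable {X : Type*} [NormedAddCommGroup X] [InnerProductSpace ℝ X]
    (Q : X →L[ℝ] X) (g : ℝ → X) (a b : ℝ)
    (hg : AEStronglyMeasurable g (volume.restrict (Icc a b)))
    (hg2 : IntegrableOn (fun s => ‖g s‖ ^ 2) (Icc a b)) :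
    IntegrableOn (fun s => ⟪g s, Q (g s)⟫) (Icc a b) := by
  refine Integrable.mono' (hg2.const_mul ‖Q‖)
    (hg.inner (Q.continuous.comp_aestronglyMeasurable hg)) (Eventually.of_forall fun s => ?_)
  calc ‖⟪g s, Q (g s)⟫‖ ≤ ‖g s‖ * ‖Q (g s)‖ := norm_inner_le_norm _ _
    _ ≤ ‖g s‖ * (‖Q‖ * ‖g s‖) := by gcongr; exact Q.le_opNorm _
    _ = ‖Q‖ * ‖g s‖ ^ 2 := by ring

theorem cost_eq_zero_iff
    {X : Type*} [NormedAddCommGroup X] [InnerProductSpace ℝ X] [FiniteDimensional ℝ X]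
    (A B Binv : X →L[ℝ] X)
    (hAsymm : ∀ x y : X, ⟪A x, y⟫ = ⟪x, A y⟫)
    (hApos : ∀ x : X, x ≠ 0 → 0 < ⟪x, A x⟫)
    (hBsymm : ∀ x y : X, ⟪B x, y⟫ = ⟪x, B y⟫)
    (hBpos : ∀ x : X, x ≠ 0 → 0 < ⟪x, B x⟫)
    -- Binv is the inverse of B
    (hBinv₁ : ∀ x : X, Binv (B x) = x) (hBinv₂ : ∀ x : X, B (Binv x) = x)
    (T : ℝ) (hT : 0 < T)
    (F dtF : ℝ → X → ℝ) (gradF : ℝ → X → X)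
    -- (F0)
    (hF0 : ContDiffOn ℝ 1 (fun p : ℝ × X => F p.1 p.2) (Set.Icc 0 T ×ˢ Set.univ))
    (hgradF : ∀ t ∈ Set.Icc 0 T, ∀ x : X, HasGradientAt (F t) (gradF t x) x)
    (hdtF : ∀ x : X, ∀ t ∈ Set.Icc 0 T,
      HasDerivWithinAt (fun τ => F τ x) (dtF t x) (Set.Icc 0 T) t)
    -- (F1)
    (hF1 : ∀ ρ > (0 : ℝ), Bornology.IsBounded {x : X | ∀ t ∈ Set.Icc 0 T, |F t x| ≤ ρ})
    -- (F2)
    (C₁ C₂ : ℝ) (hC₁ : 0 < C₁) (hC₂ : 0 < C₂)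
    (hF2 : ∀ t ∈ Set.Icc 0 T, ∀ x : X, |dtF t x| ≤ C₁ * F t x + C₂)
    -- (F3)
    (dtgradF : ℝ → X → X)
    (hdtgradF : ∀ x : X, ∀ t ∈ Set.Icc 0 T,
      HasDerivWithinAt (fun τ => gradF τ x) (dtgradF t x) (Set.Icc 0 T) t)
    (hF3 : ∀ M > (0 : ℝ), ∃ a : ℝ → ℝ, MeasureTheory.IntegrableOn a (Set.Icc 0 T) ∧
      ∀ t ∈ Set.Icc 0 T, ∀ x : X, ‖x‖ ≤ M → ‖dtgradF t x‖ ≤ a t)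
    -- (F4)
    (hessF : ℝ → X → X →L[ℝ] X)
    (hF4 : ∀ t ∈ Set.Icc 0 T, ContDiff ℝ 2 (F t))
    (hhessF : ∀ t ∈ Set.Icc 0 T, ∀ x : X, HasFDerivAt (gradF t) (hessF t x) x)
    (hhessFc : ContinuousOn (fun p : ℝ × X => hessF p.1 p.2) (Set.Icc 0 T ×ˢ Set.univ))
    -- (F5)
    (hF5 : ∀ t ∈ Set.Icc 0 T, ∀ x : X, gradF t x = 0 →
      ∃ r > (0 : ℝ), ∀ y : X, gradF t y = 0 → y ∈ Metric.ball x r → y = x)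
    (t : ℝ) (ht : t ∈ Set.Icc 0 T) (u₁ u₂ : X) :
    cost A B Binv gradF t u₁ u₂ = 0 ↔ u₁ = u₂ := by
  have : ProperSpace X := FiniteDimensional.proper ℝ X
  have : CompleteSpace X := FiniteDimensional.complete ℝ X
  have hBinvpos : ∀ x : X, x ≠ 0 → 0 < ⟪x, Binv x⟫ := by
    intro x hx
    have h0 : Binv x ≠ 0 := by
      intro h
      apply hx
      rw [← hBinv₂ x, h, map_zero]
    have := hBpos _ h0
    rwa [hBinv₂, real_inner_comm] at this
  have hG : Continuous (gradF t) :=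
    continuous_iff_continuousAt.mpr fun x => (hhessF t ht x).continuousAt
  obtain ⟨β₁, hβ₁, hB1⟩ := posdef_coercive B hBpos
  obtain ⟨β₂, hβ₂, hB2⟩ := posdef_coercive Binv hBinvpos
  have hB1n : ∀ x : X, 0 ≤ ⟪x, B x⟫ := fun x => le_trans (by positivity) (hB1 x)
  have hB2n : ∀ x : X, 0 ≤ ⟪x, Binv x⟫ := fun x => le_trans (by positivity) (hB2 x)
  constructor
  · intro hcost
    by_contra hne
    have hD : 0 < dist u₂ u₁ := dist_pos.mpr (Ne.symm hne)
    -- a radius whose sphere carries no critical point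
    obtain ⟨r, hr, hru, hcrit⟩ : ∃ r > (0 : ℝ), r ≤ dist u₂ u₁ ∧
        ∀ p ∈ Metric.sphere u₁ r, gradF t p ≠ 0 := by
      by_cases h0 : gradF t u₁ = 0
      · obtain ⟨r0, hr0, h⟩ := hF5 t ht u₁ h0
        have hm : 0 < min (r0 / 2) (dist u₂ u₁) := lt_min (by linarith) hD
        refine ⟨_, hm, min_le_right _ _, fun p hp hp0 => ?_⟩
        have hpd : dist p u₁ = min (r0 / 2) (dist u₂ u₁) := hp
        have h1 := h p hp0 (by
          rw [Metric.mem_ball, hpd]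
          exact (min_le_left _ _).trans_lt (by linarith))
        rw [h1, dist_self] at hpd
        linarith
      · obtain ⟨r0, hr0, h⟩ := Metric.eventually_nhds_iff.mp
          (hG.continuousAt.eventually_ne h0)
        have hm : 0 < min (r0 / 2) (dist u₂ u₁) := lt_min (by linarith) hD
        refine ⟨_, hm, min_le_right _ _, fun p hp => h ?_⟩
        have hpd : dist p u₁ = min (r0 / 2) (dist u₂ u₁) := hp
        rw [hpd]
        exact (min_le_left _ _).trans_lt (by linarith)
    have hScpt : IsCompact (Metric.sphere u₁ r) := isCompact_sphere _ _
    obtain ⟨κ, hκ, ρ, hρ, hκρ⟩ := uniform_field (gradF t) hG _ hScpt hcrit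
    obtain ⟨M0, hM0⟩ := hScpt.exists_bound_of_continuousOn hG.continuousOn
    set M := max M0 0 with hMdef
    have hMn : 0 ≤ M := le_max_right _ _
    have hM : ∀ p ∈ Metric.sphere u₁ r, ‖gradF t p‖ ≤ M :=
      fun p hp => (hM0 p hp).trans (le_max_left _ _)
    obtain ⟨η, hη, hηr, hηρ, hηM⟩ : ∃ η > (0 : ℝ), η < r ∧ η ≤ ρ ∧
        M * (η + ‖A‖ * (8 * η)) < κ / 3 := by
      set K := M * (1 + 8 * ‖A‖) with hK
      have hKn : 0 ≤ K := by positivity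
      refine ⟨min (min (r / 2) ρ) (κ / (6 * (K + 1))), by positivity, ?_, ?_, ?_⟩
      · exact (min_le_left _ _).trans_lt ((min_le_left _ _).trans_lt (by linarith))
      · exact (min_le_left _ _).trans (min_le_right _ _)
      · set η := min (min (r / 2) ρ) (κ / (6 * (K + 1)))
        have h1 : η ≤ κ / (6 * (K + 1)) := min_le_right _ _
        have h0 : 0 < η := by positivity
        rw [le_div_iff₀ (by positivity)] at h1
        have h2 : M * (η + ‖A‖ * (8 * η)) = K * η := by rw [hK]; ring
        rw [h2]
        nlinarith
    set β := min β₁ β₂ with hβdef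
    have hβ : 0 < β := lt_min hβ₁ hβ₂
    have hpos : 0 < 1 / 2 * (β * η ^ 2) := by positivity
    have hlb : 1 / 2 * (β * η ^ 2) ≤ cost A B Binv gradF t u₁ u₂ := by
      unfold cost
      apply le_csInf
      · refine ⟨_, 1, fun s => u₁ + ((2 + 3 * s - s ^ 3) / 4) • (u₂ - u₁),
          fun s => ((3 - 3 * s ^ 2) / 4) • (u₂ - u₁), fun s => (-(3 / 2) * s) • (u₂ - u₁),
          ?_, ?_, ?_, ?_, ?_, ?_, ?_, ?_, ?_, rfl⟩
        · intro s _
          have h1 : HasDerivAt (fun s : ℝ => (2 + 3 * s - s ^ 3) / 4) ((3 - 3 * s ^ 2) / 4) s := by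
            have := ((((hasDerivAt_id s).const_mul 3).const_add 2).sub
              (hasDerivAt_pow 3 s)).div_const 4
            exact HasDerivAt.congr_deriv this (by norm_num)
          exact ((h1.smul_const (u₂ - u₁)).const_add u₁).hasDerivWithinAt
        · exact Continuous.continuousOn (by fun_prop)
        · exact Continuous.integrableOn_Icc (by fun_prop)
        · exact Continuous.integrableOn_Icc (by fun_prop)
        · intro s _
          have h2 : ∀ x ∈ uIcc (-((1 : ℕ) : ℝ)) s,
              HasDerivAt (fun s : ℝ => ((3 - 3 * s ^ 2) / 4) • (u₂ - u₁))
                ((-(3 / 2) * x) • (u₂ - u₁)) x := by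
            intro x _
            have h1 : HasDerivAt (fun s : ℝ => (3 - 3 * s ^ 2) / 4) (-(3 / 2) * x) x := by
              have := (((hasDerivAt_pow 2 x).const_mul 3).const_sub 3).div_const 4
              exact HasDerivAt.congr_deriv this (by push_cast; ring)
            exact h1.smul_const _
          rw [intervalIntegral.integral_eq_sub_of_hasDerivAt h2
            (Continuous.intervalIntegrable (by fun_prop) _ _)]
          abel
        · norm_num
        · norm_num
        · norm_num
        · norm_num
      · rintro c ⟨N, v, v', v'', hv, hv'c, hv''i, hv''2, hv', hb1, hb2, -, -, rfl⟩
        by_contra! hlt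
        have hNN : -(N : ℝ) ≤ N := by
          have : (0 : ℝ) ≤ N := Nat.cast_nonneg N
          linarith
        have hvc : ContinuousOn v (Icc (-(N : ℝ)) N) :=
          fun s hs => (hv s hs).continuousWithinAt
        have hGvc : ContinuousOn (fun s => gradF t (v s)) (Icc (-(N : ℝ)) N) :=
          hG.comp_continuousOn hvc
        have hg2 := sq_integrable A _ _ _ _ hGvc hv''i hv''2
        have hgi : IntegrableOn (fun s => gradF t (v s) + A (v'' s)) (Icc (-(N : ℝ)) N) :=
          hGvc.integrableOn_Icc.add (A.integrable_comp hv''i)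
        have hdi2 : IntegrableOn (fun s => ‖v' s‖ ^ 2) (Icc (-(N : ℝ)) N) :=
          (hv'c.norm.pow 2).integrableOn_Icc
        have hq1 := quad_integrable Binv _ _ _ hgi.aestronglyMeasurable hg2
        have hq2 := quad_integrable B _ _ _ hv'c.integrableOn_Icc.aestronglyMeasurable hdi2
        have toI : ∀ f : ℝ → ℝ, IntegrableOn f (Icc (-(N : ℝ)) N) →
            IntervalIntegrable f volume (-(N : ℝ)) N := fun f hf => by
          apply IntegrableOn.intervalIntegrable
          rwa [uIcc_of_le hNN]
        rw [intervalIntegral.integral_add (toI _ hq1) (toI _ hq2)] at hlt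
        have a1 : β * ∫ s in (-(N : ℝ))..N, ‖gradF t (v s) + A (v'' s)‖ ^ 2 ≤
            ∫ s in (-(N : ℝ))..N,
              ⟪gradF t (v s) + A (v'' s), Binv (gradF t (v s) + A (v'' s))⟫ := by
          rw [← intervalIntegral.integral_const_mul]
          apply intervalIntegral.integral_mono_on hNN ((toI _ hg2).const_mul _) (toI _ hq1)
          intro s _
          exact (mul_le_mul_of_nonneg_right (min_le_right _ _) (sq_nonneg _)).trans (hB2 _)
        have a2 : β * ∫ s in (-(N : ℝ))..N, ‖v' s‖ ^ 2 ≤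
            ∫ s in (-(N : ℝ))..N, ⟪v' s, B (v' s)⟫ := by
          rw [← intervalIntegral.integral_const_mul]
          apply intervalIntegral.integral_mono_on hNN ((toI _ hdi2).const_mul _) (toI _ hq2)
          intro s _
          exact (mul_le_mul_of_nonneg_right (min_le_left _ _) (sq_nonneg _)).trans (hB1 _)
        have p1 : 0 ≤ ∫ s in (-(N : ℝ))..N,
            ⟪gradF t (v s) + A (v'' s), Binv (gradF t (v s) + A (v'' s))⟫ :=
          intervalIntegral.integral_nonneg hNN fun s _ => hB2n _
        have p2 : 0 ≤ ∫ s in (-(N : ℝ))..N, ⟪v' s, B (v' s)⟫ :=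
          intervalIntegral.integral_nonneg hNN fun s _ => hB1n _
        exact key_estimate A (gradF t) hG u₁ u₂ r κ M ρ η hη hr hru hM hMn hκρ hκ hηr hηρ hηM
          N (Nat.cast_nonneg N) v v' v'' hv hv'c hv''i hv' hb1 hb2 hg2
          (le_of_mul_le_mul_left (by linarith) hβ) (le_of_mul_le_mul_left (by linarith) hβ)
    linarith
  · rintro rfl
    unfold cost
    apply IsLeast.csInf_eq
    constructor
    · refine ⟨0, fun _ => u₁, fun _ => 0, fun _ => 0, ?_, ?_, ?_, ?_, ?_, rfl, rfl, rfl, rfl, ?_⟩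
      · intro s _; exact hasDerivWithinAt_const _ _ _
      · exact continuousOn_const
      · simp
      · simp
      · simp
      · simp
    · rintro c ⟨N, v, v', v'', -, -, -, -, -, -, -, -, -, rfl⟩
      have hNN : -(N : ℝ) ≤ N := by
        have : (0 : ℝ) ≤ N := Nat.cast_nonneg N
        linarith
      exact mul_nonneg (by norm_num) (intervalIntegral.integral_nonneg hNN
        fun s _ => add_nonneg (hB2n _) (hB1n _))
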